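/- arXiv:2602.13317 — 8 statements merged into one kernel-verified Lean document; each statement's English description precedes it below -/
import Mathlib

section
/- Let I ⊆ ℝ be an open interval and u : ℝ → ℝ three times differentiable on I. Let U ⊆ ℂ be an open set containing the curve {u(x) + i·x : x ∈ I} and let w : ℂ → ℂ be holomorphic on U, satisfying w(u(x) + i·x) = x + i·u(x) for all x ∈ I. If w satisfies the canonical equation 2·w'''(ζ)·w'(ζ) = 3·w''(ζ)² at every point ζ = u(x) + i·x with x ∈ I, then u satisfies u'''(x)·(1 + u'(x)²) = 3·u'(x)·u''(x)² for all x ∈ I. (In other words, the complex point transformation x̄ = u + i·x, ū = x + i·u maps the equation ū''' = (3/2)·ū''²/ū' to the equation u''' = 3u'u''²/(1+u'²).) -/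
/-- Functions agreeing on an open set have the same derivative there. -/
theorem HasDerivAt.unique_of_eqOn_isOpen {E : Type*} [NormedAddCommGroup E] [NormedSpace ℝ E]
    {s : Set ℝ} (hs : IsOpen s) {f g : ℝ → E} (hfg : Set.EqOn f g s) {x : ℝ} (hx : x ∈ s)
    {f' g' : E} (hf : HasDerivAt f f' x) (hg : HasDerivAt g g' x) : f' = g' :=
  hf.unique (hg.congr_of_eventuallyEq (hfg.eventuallyEq_of_mem (hs.mem_nhds hx)))

/-- The algebraic elimination behind the transformation: `A`, `B`, `C` are the first three
derivatives of `w` along the curve, `p`, `q`, `r` those of `u`. -/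
theorem eq_of_chain_rule_of_canonical {p q r : ℝ} {A B C : ℂ}
    (h1 : A * (p + Complex.I) = 1 + Complex.I * p)
    (h2 : B * (p + Complex.I) * (p + Complex.I) + A * q = Complex.I * q)
    (h3 : (C * (p + Complex.I) * (p + Complex.I) + B * q) * (p + Complex.I)
      + B * (p + Complex.I) * q + (B * (p + Complex.I) * q + A * r) = Complex.I * r)
    (hcanon : 2 * C * A = 3 * B ^ 2) :
    r * (1 + p ^ 2) = 3 * p * q ^ 2 := by
  have hI : Complex.I ^ 2 = -1 := Complex.I_sq
  set s : ℂ := p + Complex.I with hs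
  have hA : (Complex.I - A) * s = -2 := by
    rw [sub_mul, h1, hs]; linear_combination hI
  have hB : B * s ^ 3 = -2 * q := by linear_combination s * h2 + q * hA
  have hC : C * s ^ 5 = 6 * q ^ 2 - 2 * r * s := by
    linear_combination s ^ 2 * h3 + r * s * hA - 3 * q * hB
  have key : 2 * (6 * q ^ 2 - 2 * r * s) * (1 + Complex.I * p) = 3 * (-2 * (q : ℂ)) ^ 2 := by
    rw [← hB, ← hC, ← h1]; linear_combination s ^ 6 * hcanon
  have hfin : (r : ℂ) * (1 + p ^ 2) = 3 * p * q ^ 2 := by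
    rw [hs] at key
    linear_combination (Complex.I / 4) * key
      + (-3 * q ^ 2 * p + r + r * p ^ 2 + r * p * Complex.I) * hI
  exact_mod_cast hfin


/-- The complex point transformation x̄ = u + i·x, ū = x + i·u maps the canonical
equation ū''' = (3/2)·ū''²/ū' to the equation u''' = 3u'u''²/(1+u'²). -/
theorem complex_transform_maps_canonical_to_L62
    (I : Set ℝ) (hI : IsOpen I)
    (u u' u'' u''' : ℝ → ℝ)
    (hu1 : ∀ x ∈ I, HasDerivAt u (u' x) x)
    (hu2 : ∀ x ∈ I, HasDerivAt u' (u'' x) x)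
    (hu3 : ∀ x ∈ I, HasDerivAt u'' (u''' x) x)
    (U : Set ℂ) (hU : IsOpen U)
    (hcurve : ∀ x ∈ I, ((u x : ℂ) + Complex.I * (x : ℂ)) ∈ U)
    (w w' w'' w''' : ℂ → ℂ)
    (hw1 : ∀ z ∈ U, HasDerivAt w (w' z) z)
    (hw2 : ∀ z ∈ U, HasDerivAt w' (w'' z) z)
    (hw3 : ∀ z ∈ U, HasDerivAt w'' (w''' z) z)
    (hw : ∀ x ∈ I, w ((u x : ℂ) + Complex.I * (x : ℂ)) = (x : ℂ) + Complex.I * (u x : ℂ))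
    (hcanon : ∀ x ∈ I,
      2 * w''' ((u x : ℂ) + Complex.I * (x : ℂ)) * w' ((u x : ℂ) + Complex.I * (x : ℂ))
        = 3 * (w'' ((u x : ℂ) + Complex.I * (x : ℂ)))^2) :
    ∀ x ∈ I, u''' x * (1 + (u' x)^2) = 3 * u' x * (u'' x)^2 := by
  have hγ : ∀ x ∈ I, HasDerivAt (fun t : ℝ => (u t : ℂ) + Complex.I * (t : ℂ))
      (u' x + Complex.I) x := fun x hx => by
    simpa using (hu1 x hx).ofReal_comp.fun_add
      ((hasDerivAt_id x).ofReal_comp.const_mul Complex.I)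
  have h1 : ∀ x ∈ I, w' ((u x : ℂ) + Complex.I * (x : ℂ)) * (u' x + Complex.I)
      = 1 + Complex.I * u' x := fun x hx =>
    HasDerivAt.unique_of_eqOn_isOpen hI hw hx
      ((hw1 _ (hcurve x hx)).comp x (hγ x hx))
      (by simpa using (hasDerivAt_id x).ofReal_comp.fun_add
            ((hu1 x hx).ofReal_comp.const_mul Complex.I))
  have hγ' : ∀ x ∈ I, HasDerivAt (fun t : ℝ => (u' t : ℂ) + Complex.I) (u'' x : ℂ) x :=
    fun x hx => (hu2 x hx).ofReal_comp.add_const _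
  have h2 : ∀ x ∈ I, w'' ((u x : ℂ) + Complex.I * (x : ℂ)) * (u' x + Complex.I)
      * (u' x + Complex.I) + w' ((u x : ℂ) + Complex.I * (x : ℂ)) * u'' x
      = Complex.I * u'' x := fun x hx =>
    HasDerivAt.unique_of_eqOn_isOpen hI h1 hx
      (((hw2 _ (hcurve x hx)).comp x (hγ x hx)).mul (hγ' x hx))
      (((hu2 x hx).ofReal_comp.const_mul Complex.I).const_add 1)
  intro x hx
  have hw'x := (hw2 _ (hcurve x hx)).comp x (hγ x hx)
  have hw''x := (hw3 _ (hcurve x hx)).comp x (hγ x hx)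
  have h3 := HasDerivAt.unique_of_eqOn_isOpen hI h2 hx
    (((hw''x.mul (hγ' x hx)).mul (hγ' x hx)).add (hw'x.mul (hu3 x hx).ofReal_comp))
    ((hu3 x hx).ofReal_comp.const_mul Complex.I)
  exact eq_of_chain_rule_of_canonical (h1 x hx) (h2 x hx) h3 (hcanon x hx)
end

section
/- Let I ⊆ ℝ be an open interval, α ∈ ℂ, and u : ℝ → ℂ three times differentiable on I with 1 + u'(x)² ≠ 0 for all x ∈ I. Let U ⊆ ℂ be an open set containing the curve {u(x) + i·x : x ∈ I} and w : ℂ → ℂ holomorphic on U with w(u(x) + i·x) = x + i·u(x) for all x ∈ I. If w satisfies w'''(ζ)·w'(ζ) = α·w''(ζ)² at every point ζ = u(x) + i·x with x ∈ I, then u satisfies u'''(x) = 3·u'(x)·u''(x)²/(1 + u'(x)²) + i·(2α − 3)·u''(x)²/(1 + u'(x)²) for all x ∈ I. (The complex point transformation x̄ = u + i·x, ū = x + i·u maps ū''' = α·ū''²/ū' to u''' = 3u'u''²/(1+u'²) + i(2α−3)u''²/(1+u'²).) -/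
/-- Two functions that agree on an open set have the same derivatives there. -/
theorem deriv_values_eq_of_eqOn_isOpen {I : Set ℝ} (hI : IsOpen I) {f g : ℝ → ℂ}
    (hfg : Set.EqOn f g I) {x : ℝ} (hx : x ∈ I) {a b : ℂ} (hf : HasDerivAt f a x)
    (hg : HasDerivAt g b x) : a = b :=
  hf.unique (hg.congr_of_eventuallyEq (hfg.eventuallyEq_of_mem (hI.mem_nhds hx)))

/-- Eliminating the derivatives `w₁`, `w₂`, `w₃` from the equations obtained by differentiating
`w (u + i x) = x + i u` three times, with `p`, `q`, `r` the derivatives of `u`. -/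
theorem third_derivative_eq_of_transform {p q r w₁ w₂ w₃ α : ℂ} (hp : 1 + p ^ 2 ≠ 0)
    (h₁ : w₁ * (p + Complex.I) = 1 + Complex.I * p)
    (h₂ : w₂ * (p + Complex.I) ^ 2 + w₁ * q = Complex.I * q)
    (h₃ : w₃ * (p + Complex.I) ^ 3 + 3 * w₂ * (p + Complex.I) * q + w₁ * r = Complex.I * r)
    (hα : w₃ * w₁ = α * w₂ ^ 2) :
    r = 3 * p * q ^ 2 / (1 + p ^ 2) + Complex.I * (2 * α - 3) * q ^ 2 / (1 + p ^ 2) := by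
  have hI := Complex.I_sq
  have e₂ : w₂ * (p + Complex.I) ^ 3 = -2 * q := by
    linear_combination (p + Complex.I) * h₂ - q * h₁ + q * hI
  have e₃ : w₃ * (p + Complex.I) ^ 5 = -2 * r * (p + Complex.I) + 6 * q ^ 2 := by
    linear_combination (p + Complex.I) ^ 2 * h₃ - 3 * q * e₂ - r * (p + Complex.I) * h₁
      + r * (p + Complex.I) * hI
  have e : (-2 * r * (p + Complex.I) + 6 * q ^ 2) * (1 + Complex.I * p) = α * (-2 * q) ^ 2 := by
    rw [← e₂, ← e₃, ← h₁]
    linear_combination (p + Complex.I) ^ 6 * hα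
  rw [← add_div, eq_div_iff hp]
  linear_combination (Complex.I / 2) * e + (r + r * p * Complex.I + r * p ^ 2 - 3 * p * q ^ 2) * hI

/-- The complex point transformation x̄ = u + i·x, ū = x + i·u maps
ū''' = α·ū''²/ū' to u''' = 3u'u''²/(1+u'²) + i(2α−3)u''²/(1+u'²). -/
theorem complex_transform_maps_L44_canonical
    (I : Set ℝ) (hI : IsOpen I) (α : ℂ)
    (u u' u'' u''' : ℝ → ℂ)
    (hu1 : ∀ x ∈ I, HasDerivAt u (u' x) x)
    (hu2 : ∀ x ∈ I, HasDerivAt u' (u'' x) x)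
    (hu3 : ∀ x ∈ I, HasDerivAt u'' (u''' x) x)
    (hden : ∀ x ∈ I, 1 + (u' x)^2 ≠ 0)
    (U : Set ℂ) (hU : IsOpen U)
    (hcurve : ∀ x ∈ I, (u x + Complex.I * (x : ℂ)) ∈ U)
    (w w' w'' w''' : ℂ → ℂ)
    (hw1 : ∀ z ∈ U, HasDerivAt w (w' z) z)
    (hw2 : ∀ z ∈ U, HasDerivAt w' (w'' z) z)
    (hw3 : ∀ z ∈ U, HasDerivAt w'' (w''' z) z)
    (hw : ∀ x ∈ I, w (u x + Complex.I * (x : ℂ)) = (x : ℂ) + Complex.I * u x)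
    (hcanon : ∀ x ∈ I,
      w''' (u x + Complex.I * (x : ℂ)) * w' (u x + Complex.I * (x : ℂ))
        = α * (w'' (u x + Complex.I * (x : ℂ)))^2) :
    ∀ x ∈ I, u''' x = 3 * u' x * (u'' x)^2 / (1 + (u' x)^2)
      + Complex.I * (2 * α - 3) * (u'' x)^2 / (1 + (u' x)^2) := by
  have hz : ∀ x ∈ I, HasDerivAt (fun t : ℝ ↦ u t + Complex.I * (t : ℂ)) (u' x + Complex.I) x :=
    fun x hx ↦ by simpa using (hu1 x hx).fun_add (Complex.ofRealCLM.hasDerivAt.const_mul Complex.I)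
  have hp : ∀ x ∈ I, HasDerivAt (fun t ↦ u' t + Complex.I) (u'' x) x :=
    fun x hx ↦ (hu2 x hx).add_const _
  have d₁ (x) (hx : x ∈ I) := (hw1 _ (hcurve x hx)).comp x (hz x hx)
  have d₂ (x) (hx : x ∈ I) := (hw2 _ (hcurve x hx)).comp x (hz x hx)
  have d₃ (x) (hx : x ∈ I) := (hw3 _ (hcurve x hx)).comp x (hz x hx)
  have h₁ : ∀ x ∈ I, w' (u x + Complex.I * (x : ℂ)) * (u' x + Complex.I)
      = 1 + Complex.I * u' x := fun x hx ↦
    deriv_values_eq_of_eqOn_isOpen hI hw hx (d₁ x hx)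
      (by simpa using Complex.ofRealCLM.hasDerivAt.fun_add ((hu1 x hx).const_mul Complex.I))
  have h₂ : ∀ x ∈ I, w'' (u x + Complex.I * (x : ℂ)) * (u' x + Complex.I) * (u' x + Complex.I)
      + w' (u x + Complex.I * (x : ℂ)) * u'' x = Complex.I * u'' x := fun x hx ↦
    deriv_values_eq_of_eqOn_isOpen hI h₁ hx ((d₂ x hx).mul (hp x hx))
      (((hu2 x hx).const_mul Complex.I).const_add 1)
  intro x hx
  have h₃ := deriv_values_eq_of_eqOn_isOpen hI h₂ hx
    ((((d₃ x hx).mul (hp x hx)).mul (hp x hx)).add ((d₂ x hx).mul (hu3 x hx)))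
    ((hu3 x hx).const_mul Complex.I)
  simp only [Function.comp_apply, Pi.mul_apply] at h₃
  exact third_derivative_eq_of_transform (hden x hx) (h₁ x hx)
    (by linear_combination h₂ x hx) (by linear_combination h₃) (hcanon x hx)
end

section
/- Let I ⊆ ℝ be an open interval and u : ℝ → ℝ three times differentiable on I with u'(x) ≠ 0 for all x ∈ I, satisfying u'''(x) = (3·u''(x)² − u'(x)⁵·exp(u''(x)/u'(x)³))/u'(x) for all x ∈ I. Let J ⊆ ℝ be open with u(I) ⊆ J and let g : ℝ → ℝ be three times differentiable on J with g(u(x)) = x for all x ∈ I. Then for every x ∈ I, g'''(u(x)) = exp(−g''(u(x))); i.e., the inverse function (the point transformation x̄ = u, ū = x) satisfies the canonical equation ū''' = e^{−ū''}. -/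
/-- Differentiating an identity `F ∘ u = h` valid on an open set, by the chain rule. -/
lemma HasDerivAt.mul_eq_of_comp_eqOn {I : Set ℝ} (hI : IsOpen I) {u F h : ℝ → ℝ}
    {x ux Fx hx : ℝ} (hxI : x ∈ I) (hF : HasDerivAt F Fx (u x)) (hu : HasDerivAt u ux x)
    (hh : HasDerivAt h hx x) (heq : ∀ t ∈ I, F (u t) = h t) : Fx * ux = hx := by
  have hev : F ∘ u =ᶠ[nhds x] h := by
    filter_upwards [hI.mem_nhds hxI] with t ht using heq t ht
  exact ((hF.comp x hu).congr_of_eventuallyEq hev.symm).unique hh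


/-- The inverse function (point transformation x̄ = u, ū = x) of a solution of
u''' = (3u''² − u'⁵·exp(u''/u'³))/u' satisfies the canonical equation ū''' = e^{−ū''}. -/
theorem hodograph_maps_example_to_exp_canonical
    (I : Set ℝ) (hI : IsOpen I)
    (u u' u'' u''' : ℝ → ℝ)
    (hu1 : ∀ x ∈ I, HasDerivAt u (u' x) x)
    (hu2 : ∀ x ∈ I, HasDerivAt u' (u'' x) x)
    (hu3 : ∀ x ∈ I, HasDerivAt u'' (u''' x) x)
    (hu' : ∀ x ∈ I, u' x ≠ 0)
    (hode : ∀ x ∈ I,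
      u''' x = (3 * (u'' x) ^ 2 - (u' x) ^ 5 * Real.exp (u'' x / (u' x) ^ 3)) / u' x)
    (J : Set ℝ) (hJ : IsOpen J) (hmaps : ∀ x ∈ I, u x ∈ J)
    (g g' g'' g''' : ℝ → ℝ)
    (hg1 : ∀ y ∈ J, HasDerivAt g (g' y) y)
    (hg2 : ∀ y ∈ J, HasDerivAt g' (g'' y) y)
    (hg3 : ∀ y ∈ J, HasDerivAt g'' (g''' y) y)
    (hinv : ∀ x ∈ I, g (u x) = x) :
    ∀ x ∈ I, g''' (u x) = Real.exp (-(g'' (u x))) := by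
  have e1 : ∀ x ∈ I, g' (u x) = (u' x)⁻¹ := fun x hx =>
    eq_inv_of_mul_eq_one_left <|
      HasDerivAt.mul_eq_of_comp_eqOn hI hx (hg1 _ (hmaps x hx)) (hu1 x hx) (hasDerivAt_id x) hinv
  have e2 : ∀ x ∈ I, g'' (u x) = -u'' x / (u' x) ^ 3 := by
    intro x hx
    have h := HasDerivAt.mul_eq_of_comp_eqOn hI hx (hg2 _ (hmaps x hx)) (hu1 x hx)
      ((hu2 x hx).fun_inv (hu' x hx)) e1
    rw [eq_div_of_mul_eq (hu' x hx) h]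
    have := hu' x hx
    field_simp
  intro x hx
  have h := HasDerivAt.mul_eq_of_comp_eqOn hI hx (hg3 _ (hmaps x hx)) (hu1 x hx)
    ((hu3 x hx).fun_neg.fun_div ((hu2 x hx).fun_pow 3) (pow_ne_zero 3 (hu' x hx))) e2
  have h0 := hu' x hx
  rw [eq_div_of_mul_eq h0 h, e2 x hx, hode x hx, neg_div, neg_neg]
  generalize Real.exp (u'' x / u' x ^ 3) = E
  field_simp
  ring
end

section
/- Let I ⊆ ℝ be an open interval and u : ℝ → ℝ three times differentiable on I with u(x) ≠ 0 and u'(x) ≠ 0 for all x ∈ I, satisfying u'''(x) = (u(x)²·u''(x)² + 2·u(x)·u'(x)²·u''(x) − 2·u'(x)⁴)/(u(x)²·u'(x)) for all x ∈ I. Define v(x) := 1/u(−x) for x ∈ −I := {−t : t ∈ I}. Then v is three times differentiable on −I, v'(x) = u'(−x)/u(−x)² ≠ 0, and v satisfies v'''(x) = v''(x)²/v'(x) for all x ∈ −I. (The point transformation x̄ = −x, ū = 1/u maps the given equation to the canonical form ū''' = ū''²/ū'.) -/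
/-- The point transformation x̄ = −x, ū = 1/u maps
u''' = (u²u''² + 2uu'²u'' − 2u'⁴)/(u²u') to the canonical form ū''' = ū''²/ū'. -/
theorem transform_example_to_L42_canonical
    (I : Set ℝ) (hI : IsOpen I)
    (u u' u'' u''' : ℝ → ℝ)
    (hu1 : ∀ x ∈ I, HasDerivAt u (u' x) x)
    (hu2 : ∀ x ∈ I, HasDerivAt u' (u'' x) x)
    (hu3 : ∀ x ∈ I, HasDerivAt u'' (u''' x) x)
    (hu0 : ∀ x ∈ I, u x ≠ 0)
    (hu'0 : ∀ x ∈ I, u' x ≠ 0)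
    (hode : ∀ x ∈ I,
      u''' x = ((u x) ^ 2 * (u'' x) ^ 2 + 2 * u x * (u' x) ^ 2 * u'' x - 2 * (u' x) ^ 4)
        / ((u x) ^ 2 * u' x)) :
    ∀ x : ℝ, -x ∈ I →
      let v : ℝ → ℝ := fun t => 1 / u (-t)
      DifferentiableAt ℝ v x ∧
      DifferentiableAt ℝ (deriv v) x ∧
      DifferentiableAt ℝ (deriv (deriv v)) x ∧
      deriv v x = u' (-x) / (u (-x)) ^ 2 ∧
      deriv v x ≠ 0 ∧
      deriv (deriv (deriv v)) x = (deriv (deriv v) x) ^ 2 / deriv v x := by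
  have comp_neg : ∀ {f : ℝ → ℝ} {d x : ℝ}, HasDerivAt f d (-x) →
      HasDerivAt (fun t => f (-t)) (-d) x := by
    intro f d x h
    simpa [Function.comp_def] using HasDerivAt.comp x h (hasDerivAt_neg x)
  intro x hx v
  have h1 : ∀ y, -y ∈ I → HasDerivAt v (u' (-y) / u (-y) ^ 2) y := by
    intro y hy
    have h := (comp_neg (hu1 _ hy)).fun_inv (hu0 _ hy)
    simpa [v, one_div] using h
  have h2 : ∀ y, -y ∈ I → HasDerivAt (fun t => u' (-t) / u (-t) ^ 2)
      (2 * u' (-y) ^ 2 / u (-y) ^ 3 - u'' (-y) / u (-y) ^ 2) y := by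
    intro y hy
    have ha := hu0 _ hy
    refine ((comp_neg (hu2 _ hy)).fun_div ((comp_neg (hu1 _ hy)).fun_pow 2)
      (pow_ne_zero 2 ha)).congr_deriv ?_
    field_simp
    ring
  have h3 : ∀ y, -y ∈ I →
      HasDerivAt (fun t => 2 * u' (-t) ^ 2 / u (-t) ^ 3 - u'' (-t) / u (-t) ^ 2)
      (u''' (-y) / u (-y) ^ 2 - 6 * u' (-y) * u'' (-y) / u (-y) ^ 3
        + 6 * u' (-y) ^ 3 / u (-y) ^ 4) y := by
    intro y hy
    have ha := hu0 _ hy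
    have h := comp_neg (hu1 _ hy)
    refine (((((comp_neg (hu2 _ hy)).fun_pow 2).const_mul 2).fun_div (h.fun_pow 3)
      (pow_ne_zero 3 ha)).fun_sub ((comp_neg (hu3 _ hy)).fun_div (h.fun_pow 2)
      (pow_ne_zero 2 ha))).congr_deriv ?_
    field_simp
    ring
  have nhds_neg : ∀ y, -y ∈ I → ∀ᶠ z in nhds y, -z ∈ I := fun y hy =>
    continuous_neg.continuousAt.eventually_mem (hI.mem_nhds hy)
  have d2 : ∀ y, -y ∈ I → HasDerivAt (deriv v)
      (2 * u' (-y) ^ 2 / u (-y) ^ 3 - u'' (-y) / u (-y) ^ 2) y := fun y hy =>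
    (h2 y hy).congr_of_eventuallyEq ((nhds_neg y hy).mono fun z hz => (h1 z hz).deriv)
  have d3 := (h3 x hx).congr_of_eventuallyEq
    ((nhds_neg x hx).mono fun z hz => (d2 z hz).deriv)
  have ha := hu0 _ hx
  have hb := hu'0 _ hx
  refine ⟨(h1 x hx).differentiableAt, (d2 x hx).differentiableAt, d3.differentiableAt,
    (h1 x hx).deriv, ?_, ?_⟩
  · rw [(h1 x hx).deriv]
    exact div_ne_zero hb (pow_ne_zero 2 ha)
  · rw [d3.deriv, (d2 x hx).deriv, (h1 x hx).deriv, hode _ hx]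
    field_simp
    ring
end

section
/- Let b ∈ ℝ with b ≠ 1, set e = (b−2)/(b−1), let I ⊆ ℝ be an open interval, and let u : ℝ → ℝ be three times differentiable on I with u''(x) > 0 for all x ∈ I, satisfying u'''(x) = (u''(x))^e for all x ∈ I. Then for any λ > 0 and any x₀, c₁, c₀ ∈ ℝ, the function v(x) := λ^{1+b}·u((x − x₀)/λ) + c₁·x + c₀, defined for x with (x − x₀)/λ ∈ I, satisfies v''(x) = λ^{b−1}·u''((x−x₀)/λ) > 0 and v'''(x) = (v''(x))^e. (This expresses that ∂_u, ∂_x, x∂_u and x∂_x + (1+b)u∂_u generate point symmetries of the canonical form u''' = (u'')^{(b−2)/(b−1)} of the algebra L₍₄;₃₎.) -/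
theorem HasDerivAt.rpow_mul_comp_sub_div {f : ℝ → ℝ} {f' lam x₀ x : ℝ} (hlam : 0 < lam) (a : ℝ)
    (hf : HasDerivAt f f' ((x - x₀) / lam)) :
    HasDerivAt (fun t => lam ^ a * f ((t - x₀) / lam)) (lam ^ (a - 1) * f') x := by
  have hg : HasDerivAt (fun t : ℝ => (t - x₀) / lam) (1 / lam) x :=
    ((hasDerivAt_id x).sub_const x₀).div_const lam
  have h := (HasDerivAt.comp x hf hg).const_mul (lam ^ a)
  have heq : lam ^ (a - 1) * f' = lam ^ a * (f' * (1 / lam)) := by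
    rw [Real.rpow_sub_one hlam.ne']
    ring
  rw [heq]
  exact h

/-- ∂_u, ∂_x, x∂_u and x∂_x + (1+b)u∂_u generate point symmetries of the canonical
form u''' = (u'')^{(b−2)/(b−1)} of the algebra L₍₄;₃₎. -/
theorem point_symmetries_L43
    (b : ℝ) (hb : b ≠ 1) (e : ℝ) (he : e = (b - 2) / (b - 1))
    (I : Set ℝ) (hI : IsOpen I)
    (u u' u'' u''' : ℝ → ℝ)
    (hu1 : ∀ x ∈ I, HasDerivAt u (u' x) x)
    (hu2 : ∀ x ∈ I, HasDerivAt u' (u'' x) x)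
    (hu3 : ∀ x ∈ I, HasDerivAt u'' (u''' x) x)
    (hpos : ∀ x ∈ I, 0 < u'' x)
    (hode : ∀ x ∈ I, u''' x = (u'' x) ^ e)
    (lam : ℝ) (hlam : 0 < lam) (x₀ c₁ c₀ : ℝ) :
    ∀ x : ℝ, (x - x₀) / lam ∈ I →
      let v : ℝ → ℝ := fun t => lam ^ (1 + b) * u ((t - x₀) / lam) + c₁ * t + c₀
      DifferentiableAt ℝ v x ∧
      DifferentiableAt ℝ (deriv v) x ∧
      DifferentiableAt ℝ (deriv (deriv v)) x ∧
      deriv (deriv v) x = lam ^ (b - 1) * u'' ((x - x₀) / lam) ∧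
      0 < deriv (deriv v) x ∧
      deriv (deriv (deriv v)) x = (deriv (deriv v) x) ^ e := by
  intro x hx v
  set S : Set ℝ := (fun t => (t - x₀) / lam) ⁻¹' I with hS
  have hSo : IsOpen S := hI.preimage (by fun_prop)
  have h1 : ∀ y ∈ S, HasDerivAt v (lam ^ b * u' ((y - x₀) / lam) + c₁) y := by
    intro y hy
    have h := (((hu1 _ hy).rpow_mul_comp_sub_div hlam (1 + b)).add
      ((hasDerivAt_id y).const_mul c₁)).add_const c₀
    rw [add_sub_cancel_left, mul_one] at h
    exact h
  have h2 : ∀ y ∈ S, HasDerivAt (deriv v) (lam ^ (b - 1) * u'' ((y - x₀) / lam)) y := by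
    intro y hy
    refine (((hu2 _ hy).rpow_mul_comp_sub_div hlam b).add_const c₁).congr_of_eventuallyEq ?_
    filter_upwards [hSo.mem_nhds hy] with z hz using (h1 z hz).deriv
  have h3 : ∀ y ∈ S, HasDerivAt (deriv (deriv v))
      (lam ^ (b - 1 - 1) * u''' ((y - x₀) / lam)) y := by
    intro y hy
    refine ((hu3 _ hy).rpow_mul_comp_sub_div hlam (b - 1)).congr_of_eventuallyEq ?_
    filter_upwards [hSo.mem_nhds hy] with z hz using (h2 z hz).deriv
  have hu := hpos _ hx
  refine ⟨(h1 x hx).differentiableAt, (h2 x hx).differentiableAt, (h3 x hx).differentiableAt,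
    (h2 x hx).deriv, ?_, ?_⟩
  · rw [(h2 x hx).deriv]
    positivity
  · have hexp : (b - 1) * e = b - 1 - 1 := by
      rw [he, mul_div_cancel₀ _ (sub_ne_zero.mpr hb)]
      ring
    rw [(h3 x hx).deriv, (h2 x hx).deriv, hode _ hx, Real.mul_rpow (by positivity) hu.le,
      ← Real.rpow_mul hlam.le, hexp]
end

section
/- Let α ∈ ℝ, let I ⊆ (0, ∞) be an open interval, and let u : ℝ → ℝ be three times differentiable on I with u'(x) > 0 and 2x·u''(x) + u'(x) ≥ 0 for all x ∈ I, satisfying u'''(x) = 3·u''(x)²/u'(x) + α·(2x·u''(x) + u'(x))^{3/2}/(x²·√(u'(x))) for all x ∈ I. Then for any λ > 0, μ > 0 and c ∈ ℝ, the function v(x) := μ·u(x/λ) + c, defined for x with x/λ ∈ I, satisfies v'(x) > 0, 2x·v''(x) + v'(x) ≥ 0, and v'''(x) = 3·v''(x)²/v'(x) + α·(2x·v''(x) + v'(x))^{3/2}/(x²·√(v'(x))). (This expresses that ∂_u, x∂_x + u∂_u and x∂_x generate point symmetries of the canonical form of the algebra L₍₄;₅₎^{II}.) -/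
theorem HasDerivAt.const_mul_comp_div_add {f : ℝ → ℝ} {f' l x : ℝ} (k c : ℝ)
    (hf : HasDerivAt f f' (x / l)) :
    HasDerivAt (fun t => k * f (t / l) + c) (k / l * f') x := by
  have h := ((hf.comp x ((hasDerivAt_id x).div_const l)).const_mul k).add_const c
  exact h.congr_deriv (by ring)

theorem Real.rpow_three_halves {x : ℝ} (hx : 0 ≤ x) :
    x ^ ((3 : ℝ) / 2) = x * √x := by
  rw [show (3 : ℝ) / 2 = 1 + 1 / 2 by norm_num,
    Real.rpow_add_of_nonneg hx zero_le_one (by norm_num), Real.rpow_one, Real.sqrt_eq_rpow]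


/-- ∂_u, x∂_x + u∂_u and x∂_x generate point symmetries of the canonical form of
the algebra L₍₄;₅₎^{II}. -/
theorem point_symmetries_L45II
    (α : ℝ) (I : Set ℝ) (hI : IsOpen I) (hIpos : I ⊆ Set.Ioi (0 : ℝ))
    (u u' u'' u''' : ℝ → ℝ)
    (hu1 : ∀ x ∈ I, HasDerivAt u (u' x) x)
    (hu2 : ∀ x ∈ I, HasDerivAt u' (u'' x) x)
    (hu3 : ∀ x ∈ I, HasDerivAt u'' (u''' x) x)
    (hu' : ∀ x ∈ I, 0 < u' x)
    (hnn : ∀ x ∈ I, 0 ≤ 2 * x * u'' x + u' x)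
    (hode : ∀ x ∈ I,
      u''' x = 3 * (u'' x) ^ 2 / u' x
        + α * (2 * x * u'' x + u' x) ^ ((3 : ℝ) / 2) / (x ^ 2 * Real.sqrt (u' x)))
    (lam mu c : ℝ) (hlam : 0 < lam) (hmu : 0 < mu) :
    ∀ x : ℝ, x / lam ∈ I →
      let v : ℝ → ℝ := fun t => mu * u (t / lam) + c
      DifferentiableAt ℝ v x ∧
      DifferentiableAt ℝ (deriv v) x ∧
      DifferentiableAt ℝ (deriv (deriv v)) x ∧
      0 < deriv v x ∧
      0 ≤ 2 * x * deriv (deriv v) x + deriv v x ∧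
      deriv (deriv (deriv v)) x = 3 * (deriv (deriv v) x) ^ 2 / deriv v x
        + α * (2 * x * deriv (deriv v) x + deriv v x) ^ ((3 : ℝ) / 2)
          / (x ^ 2 * Real.sqrt (deriv v x)) := by
  intro x hx v
  have hJ : IsOpen {t : ℝ | t / lam ∈ I} := hI.preimage (continuous_id.div_const lam)
  have hv1 : ∀ t, t / lam ∈ I → HasDerivAt v (mu / lam * u' (t / lam)) t := fun t ht =>
    (hu1 _ ht).const_mul_comp_div_add mu c
  have hv2 : ∀ t, t / lam ∈ I → HasDerivAt (deriv v) (mu / lam / lam * u'' (t / lam)) t := by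
    intro t ht
    refine ((hu2 _ ht).const_mul_comp_div_add (mu / lam) 0).congr_of_eventuallyEq ?_
    filter_upwards [hJ.mem_nhds ht] with s hs
    rw [(hv1 s hs).deriv, add_zero]
  have hv3 : HasDerivAt (deriv (deriv v)) (mu / lam / lam / lam * u''' (x / lam)) x := by
    refine ((hu3 _ hx).const_mul_comp_div_add (mu / lam / lam) 0).congr_of_eventuallyEq ?_
    filter_upwards [hJ.mem_nhds hx] with s hs
    rw [(hv2 s hs).deriv, add_zero]
  refine ⟨(hv1 x hx).differentiableAt, (hv2 x hx).differentiableAt, hv3.differentiableAt, ?_⟩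
  rw [hv3.deriv, (hv2 x hx).deriv, (hv1 x hx).deriv, hode _ hx]
  have hp : 0 < x / lam := hIpos hx
  have ha := hu' _ hx
  have hb := hnn _ hx
  have hk : 0 < mu / lam := div_pos hmu hlam
  clear hode hv1 hv2 hv3
  obtain ⟨p, rfl⟩ : ∃ p, x = lam * p := ⟨x / lam, by field_simp⟩
  rw [mul_div_cancel_left₀ p hlam.ne'] at *
  have hw : 2 * (lam * p) * (mu / lam / lam * u'' p) + mu / lam * u' p
      = mu / lam * (2 * p * u'' p + u' p) := by field_simp
  rw [hw]
  refine ⟨mul_pos hk ha, mul_nonneg hk.le hb, ?_⟩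
  rw [Real.rpow_three_halves hb, Real.rpow_three_halves (mul_nonneg hk.le hb),
    Real.sqrt_mul hk.le, Real.sqrt_mul hk.le]
  have hsk := Real.sqrt_pos.2 hk
  have hsa := Real.sqrt_pos.2 ha
  generalize √(mu / lam) = r at *
  generalize √(u' p) = q at *
  field_simp
end

section
/- For the function f(x,u,p,q) = 3pq²/(1+p²), the relative invariants satisfy: I₁ = −6pq/(1+p²), I₂ = −q²/(1+p²), I₃ = p/(1+p²), I₄ = 0, I₅ = −1/(1+p²)² ≠ 0, I₆ = 0, and, choosing J₅ := 1/(1+p²), I₇ := (1/3)·I₁·J₅ − ∂J₅/∂x − p·∂J₅/∂u + 2q·I₃·J₅ = 0. Hence the ODE u''' = 3u'u''²/(1+u'²) belongs to the branch I₄ = 0, I₅ ≠ 0, I₆ = 0, I₇ = 0 of Theorem 3.4 and is equivalent under a point transformation to ū''' = (3/2)·ū''²/ū'. -/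
noncomputable section

/-- Partial derivative of a jet function `g(x,u,p,q)` with respect to `x`. -/
def Px (g : ℝ → ℝ → ℝ → ℝ → ℝ) (x u p q : ℝ) : ℝ := deriv (fun t => g t u p q) x

/-- Partial derivative of a jet function `g(x,u,p,q)` with respect to `u`. -/
def Pu (g : ℝ → ℝ → ℝ → ℝ → ℝ) (x u p q : ℝ) : ℝ := deriv (fun t => g x t p q) u

/-- Partial derivative of a jet function `g(x,u,p,q)` with respect to `p`. -/
def Pp (g : ℝ → ℝ → ℝ → ℝ → ℝ) (x u p q : ℝ) : ℝ := deriv (fun t => g x u t q) p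

/-- Partial derivative of a jet function `g(x,u,p,q)` with respect to `q`. -/
def Pq (g : ℝ → ℝ → ℝ → ℝ → ℝ) (x u p q : ℝ) : ℝ := deriv (fun t => g x u p t) q

/-- The total derivative operator D̂ₓ = ∂ₓ + p·∂ᵤ + q·∂ₚ + f·∂_q applied to `g`. -/
def DxTot (f g : ℝ → ℝ → ℝ → ℝ → ℝ) (x u p q : ℝ) : ℝ :=
  Px g x u p q + p * Pu g x u p q + q * Pp g x u p q + f x u p q * Pq g x u p q

/-- The relative invariant I₁ = −f_q. -/
def I1 (f : ℝ → ℝ → ℝ → ℝ → ℝ) (x u p q : ℝ) : ℝ := -(Pq f x u p q)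

/-- The relative invariant I₂ = −(2/9)I₁² − f_p − (1/3)·D̂ₓI₁. -/
def I2 (f : ℝ → ℝ → ℝ → ℝ → ℝ) (x u p q : ℝ) : ℝ :=
  -(2 / 9) * (I1 f x u p q) ^ 2 - Pp f x u p q - (1 / 3) * DxTot f (I1 f) x u p q

/-- The relative invariant I₃ = −(1/6)·∂I₁/∂q. -/
def I3 (f : ℝ → ℝ → ℝ → ℝ → ℝ) (x u p q : ℝ) : ℝ := -(1 / 6) * Pq (I1 f) x u p q

/-- The relative invariant I₄ = −(1/3)I₁I₂ − f_u − (1/2)·D̂ₓI₂. -/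
def I4 (f : ℝ → ℝ → ℝ → ℝ → ℝ) (x u p q : ℝ) : ℝ :=
  -(1 / 3) * I1 f x u p q * I2 f x u p q - Pu f x u p q - (1 / 2) * DxTot f (I2 f) x u p q

/-- The relative invariant I₅ = (1/3)I₁·∂I₃/∂q − I₃² − ∂I₃/∂p. -/
def I5 (f : ℝ → ℝ → ℝ → ℝ → ℝ) (x u p q : ℝ) : ℝ :=
  (1 / 3) * I1 f x u p q * Pq (I3 f) x u p q - (I3 f x u p q) ^ 2 - Pp (I3 f) x u p q

/-- The relative invariant I₆ = −∂I₃/∂q. -/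
def I6 (f : ℝ → ℝ → ℝ → ℝ → ℝ) (x u p q : ℝ) : ℝ := -(Pq (I3 f) x u p q)

/-- The right-hand side of `D³u = 3 Du (D²u)² / (1 + (Du)²)`. -/
def circleRhs : ℝ → ℝ → ℝ → ℝ → ℝ := fun _ _ p q => 3 * p * q ^ 2 / (1 + p ^ 2)

theorem hasDerivAt_div_one_add_sq (a p : ℝ) :
    HasDerivAt (fun t : ℝ => a * t / (1 + t ^ 2)) (a * (1 - p ^ 2) / (1 + p ^ 2) ^ 2) p := by
  have hp : (1 + p ^ 2 : ℝ) ≠ 0 := by positivity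
  refine (((hasDerivAt_id' p).const_mul a).fun_div
    (((hasDerivAt_id' p).fun_pow 2).const_add 1) hp).congr_deriv ?_
  norm_num
  ring

theorem hasDerivAt_const_div_one_add_sq (a p : ℝ) :
    HasDerivAt (fun t : ℝ => a / (1 + t ^ 2)) (-(2 * a * p) / (1 + p ^ 2) ^ 2) p := by
  have hp : (1 + p ^ 2 : ℝ) ≠ 0 := by positivity
  refine ((hasDerivAt_const p a).fun_div
    (((hasDerivAt_id' p).fun_pow 2).const_add 1) hp).congr_deriv ?_
  norm_num
  ring

theorem hasDerivAt_const_mul_sq (a q : ℝ) :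
    HasDerivAt (fun t : ℝ => a * t ^ 2) (2 * a * q) q := by
  refine (((hasDerivAt_id' q).fun_pow 2).const_mul a).congr_deriv ?_
  norm_num
  ring

theorem hasDerivAt_const_mul' (a q : ℝ) : HasDerivAt (fun t : ℝ => a * t) a q := by
  simpa using (hasDerivAt_id' q).const_mul a

theorem I1_circleRhs : I1 circleRhs = fun _ _ p q => -6 * p * q / (1 + p ^ 2) := by
  funext x u p q
  have h : Pq circleRhs x u p q = 2 * (3 * p / (1 + p ^ 2)) * q := by
    rw [← (hasDerivAt_const_mul_sq _ q).deriv]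
    unfold Pq circleRhs
    congr 1
    funext t
    ring
  rw [I1, h]
  ring

theorem Pp_circleRhs (x u p q : ℝ) :
    Pp circleRhs x u p q = 3 * q ^ 2 * (1 - p ^ 2) / (1 + p ^ 2) ^ 2 := by
  rw [← (hasDerivAt_div_one_add_sq _ p).deriv]
  unfold Pp circleRhs
  congr 1
  funext t
  ring

theorem Pq_I1_circleRhs (x u p q : ℝ) :
    Pq (I1 circleRhs) x u p q = -6 * p / (1 + p ^ 2) := by
  rw [← (hasDerivAt_const_mul' (-6 * p / (1 + p ^ 2)) q).deriv, I1_circleRhs]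
  unfold Pq
  congr 1
  funext t
  ring

theorem Pp_I1_circleRhs (x u p q : ℝ) :
    Pp (I1 circleRhs) x u p q = -6 * q * (1 - p ^ 2) / (1 + p ^ 2) ^ 2 := by
  rw [← (hasDerivAt_div_one_add_sq _ p).deriv, I1_circleRhs]
  unfold Pp
  congr 1
  funext t
  ring

theorem I2_circleRhs : I2 circleRhs = fun _ _ p q => -q ^ 2 / (1 + p ^ 2) := by
  funext x u p q
  have hx : Px (I1 circleRhs) x u p q = 0 := by simp [Px, I1_circleRhs]
  have hu : Pu (I1 circleRhs) x u p q = 0 := by simp [Pu, I1_circleRhs]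
  have hp : (1 + p ^ 2 : ℝ) ≠ 0 := by positivity
  rw [I2, DxTot, hx, hu, Pp_I1_circleRhs, Pq_I1_circleRhs, Pp_circleRhs, I1_circleRhs, circleRhs]
  field_simp
  ring

theorem I3_circleRhs : I3 circleRhs = fun _ _ p _ => p / (1 + p ^ 2) := by
  funext x u p q
  rw [I3, Pq_I1_circleRhs]
  ring

theorem I4_circleRhs (x u p q : ℝ) : I4 circleRhs x u p q = 0 := by
  have hx : Px (I2 circleRhs) x u p q = 0 := by simp [Px, I2_circleRhs]
  have hu : Pu (I2 circleRhs) x u p q = 0 := by simp [Pu, I2_circleRhs]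
  have hfu : Pu circleRhs x u p q = 0 := by simp [Pu, circleRhs]
  have hpp : Pp (I2 circleRhs) x u p q = -(2 * (-q ^ 2) * p) / (1 + p ^ 2) ^ 2 := by
    rw [I2_circleRhs]
    exact (hasDerivAt_const_div_one_add_sq (-q ^ 2) p).deriv
  have hqq : Pq (I2 circleRhs) x u p q = 2 * (-1 / (1 + p ^ 2)) * q := by
    rw [← (hasDerivAt_const_mul_sq _ q).deriv, I2_circleRhs]
    unfold Pq
    congr 1
    funext t
    ring
  have hp : (1 + p ^ 2 : ℝ) ≠ 0 := by positivity
  rw [I4, DxTot, hx, hu, hfu, hpp, hqq, I1_circleRhs, I2_circleRhs, circleRhs]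
  field_simp
  ring

theorem Pq_I3_circleRhs (x u p q : ℝ) : Pq (I3 circleRhs) x u p q = 0 := by
  simp [Pq, I3_circleRhs]

theorem I5_circleRhs (x u p q : ℝ) : I5 circleRhs x u p q = -1 / (1 + p ^ 2) ^ 2 := by
  have hpp : Pp (I3 circleRhs) x u p q = 1 * (1 - p ^ 2) / (1 + p ^ 2) ^ 2 := by
    rw [← (hasDerivAt_div_one_add_sq _ p).deriv, I3_circleRhs]
    simp [Pp]
  have hp : (1 + p ^ 2 : ℝ) ≠ 0 := by positivity
  rw [I5, Pq_I3_circleRhs, hpp, I3_circleRhs]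
  field_simp
  ring

theorem I6_circleRhs (x u p q : ℝ) : I6 circleRhs x u p q = 0 := by
  rw [I6, Pq_I3_circleRhs, neg_zero]

/-- For f = 3pq²/(1+p²) (the ODE u''' = 3u'u''²/(1+u'²)), the relative invariants
satisfy I₁ = −6pq/(1+p²), I₂ = −q²/(1+p²), I₃ = p/(1+p²), I₄ = 0,
I₅ = −1/(1+p²)² ≠ 0, I₆ = 0, and with J₅ = 1/(1+p²) also I₇ = 0: the ODE belongs
to the branch I₄ = 0, I₅ ≠ 0, I₆ = 0, I₇ = 0 of Theorem 3.4. -/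
theorem canonical_L62_branch :
    ∀ x u p q : ℝ,
      let f : ℝ → ℝ → ℝ → ℝ → ℝ := fun _ _ p q => 3 * p * q ^ 2 / (1 + p ^ 2)
      let J5 : ℝ → ℝ → ℝ → ℝ → ℝ := fun _ _ p _ => 1 / (1 + p ^ 2)
      I1 f x u p q = -6 * p * q / (1 + p ^ 2) ∧
      I2 f x u p q = -q ^ 2 / (1 + p ^ 2) ∧
      I3 f x u p q = p / (1 + p ^ 2) ∧
      I4 f x u p q = 0 ∧
      I5 f x u p q = -1 / (1 + p ^ 2) ^ 2 ∧
      I5 f x u p q ≠ 0 ∧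
      I6 f x u p q = 0 ∧
      (1 / 3) * I1 f x u p q * J5 x u p q - Px J5 x u p q - p * Pu J5 x u p q
        + 2 * q * I3 f x u p q * J5 x u p q = 0 := by
  intro x u p q f J5
  have hp : (1 + p ^ 2 : ℝ) ≠ 0 := by positivity
  change I1 circleRhs x u p q = _ ∧ I2 circleRhs x u p q = _ ∧ I3 circleRhs x u p q = _ ∧
    I4 circleRhs x u p q = _ ∧ I5 circleRhs x u p q = _ ∧ I5 circleRhs x u p q ≠ 0 ∧
    I6 circleRhs x u p q = 0 ∧ (1 / 3) * I1 circleRhs x u p q * J5 x u p q - Px J5 x u p q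
      - p * Pu J5 x u p q + 2 * q * I3 circleRhs x u p q * J5 x u p q = 0
  have hx : Px J5 x u p q = 0 := by simp [Px, J5]
  have hu : Pu J5 x u p q = 0 := by simp [Pu, J5]
  refine ⟨by rw [I1_circleRhs], by rw [I2_circleRhs], by rw [I3_circleRhs],
    I4_circleRhs x u p q, I5_circleRhs x u p q, ?_, I6_circleRhs x u p q, ?_⟩
  · rw [I5_circleRhs]
    exact div_ne_zero (by norm_num) (pow_ne_zero 2 hp)
  · rw [hx, hu, I1_circleRhs, I3_circleRhs]
    ring
end
end

section
/- Let b ∈ ℝ with b ≠ 1 and set e = (b−2)/(b−1). For the function f(x,u,p,q) = q^e on the domain q > 0 (real power), the relative invariants satisfy: I₁ = −e·q^{e−1}, I₂ = e(e−3)/9·q^{2e−2}, I₃ = e(e−1)/6·q^{e−2}, I₄ = e(e−3)(3−2e)/27·q^{3e−3}, and I₆ = −e(e−1)(e−2)/6·q^{e−3}. Consequently I₄ ≠ 0 and I₆ ≠ 0 hold for all q > 0 if and only if b ∉ {−1, 0, 1/2, 2}; i.e., for b ∉ {−1, 0, 1/2, 1, 2} the ODE u''' = (u'')^{(b−2)/(b−1)}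 belongs to the branch I₄ ≠ 0, I₆ ≠ 0 of Theorem 3.1, while for b ∈ {−1, 0, 1/2} it does not. -/
noncomputable section

/-- The jet function `g` equals `c * q ^ a` on the domain `q > 0`. -/
def EqMonomial (g : ℝ → ℝ → ℝ → ℝ → ℝ) (c a : ℝ) : Prop :=
  ∀ x u p q : ℝ, 0 < q → g x u p q = c * q ^ a

namespace EqMonomial

variable {f g : ℝ → ℝ → ℝ → ℝ → ℝ} {c a d k : ℝ}

theorem px_eq_zero (hg : EqMonomial g c a) (x u p : ℝ) {q : ℝ} (hq : 0 < q) :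
    Px g x u p q = 0 := by
  have h : (fun t => g t u p q) = fun _ => c * q ^ a := funext fun t => hg t u p q hq
  simp [Px, h]

theorem pu_eq_zero (hg : EqMonomial g c a) (x u p : ℝ) {q : ℝ} (hq : 0 < q) :
    Pu g x u p q = 0 := by
  have h : (fun t => g x t p q) = fun _ => c * q ^ a := funext fun t => hg x t p q hq
  simp [Pu, h]

theorem pp_eq_zero (hg : EqMonomial g c a) (x u p : ℝ) {q : ℝ} (hq : 0 < q) :
    Pp g x u p q = 0 := by
  have h : (fun t => g x u t q) = fun _ => c * q ^ a := funext fun t => hg x u t q hq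
  simp [Pp, h]

theorem pq (hg : EqMonomial g c a) : EqMonomial (Pq g) (c * a) (a - 1) := by
  intro x u p q hq
  have h : (fun t => g x u p t) =ᶠ[nhds q] fun t => c * t ^ a := by
    filter_upwards [lt_mem_nhds hq] with t ht using hg x u p t ht
  rw [Pq, h.deriv_eq, ((Real.hasDerivAt_rpow_const (Or.inl hq.ne')).const_mul c).deriv, mul_assoc]

theorem dxTot (hf : EqMonomial f d k) (hg : EqMonomial g c a) :
    EqMonomial (DxTot f g) (d * (c * a)) (k + (a - 1)) := by
  intro x u p q hq
  rw [DxTot, hg.px_eq_zero x u p hq, hg.pu_eq_zero x u p hq, hg.pp_eq_zero x u p hq,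
    hf x u p q hq, hg.pq x u p q hq, Real.rpow_add hq]
  ring

theorem congr_params (hg : EqMonomial g c a) (hc : c = d) (ha : a = k) : EqMonomial g d k := by
  subst hc ha
  exact hg

end EqMonomial

section PowerInvariants

variable {f : ℝ → ℝ → ℝ → ℝ → ℝ} {e : ℝ}

theorem I1_eqMonomial (hf : EqMonomial f 1 e) : EqMonomial (I1 f) (-e) (e - 1) := by
  intro x u p q hq
  rw [I1, hf.pq x u p q hq]
  ring

theorem I2_eqMonomial (hf : EqMonomial f 1 e) :
    EqMonomial (I2 f) (e * (e - 3) / 9) (2 * e - 2) := by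
  intro x u p q hq
  have h1 := I1_eqMonomial hf
  have hD := (hf.dxTot h1).congr_params (k := 2 * e - 2) rfl (by ring)
  have hsq : (q ^ (e - 1)) ^ 2 = q ^ (2 * e - 2) := by
    rw [sq, ← Real.rpow_add hq]
    congr 1
    ring
  rw [I2, h1 x u p q hq, hf.pp_eq_zero x u p hq, hD x u p q hq, mul_pow, hsq]
  ring

theorem I3_eqMonomial (hf : EqMonomial f 1 e) :
    EqMonomial (I3 f) (e * (e - 1) / 6) (e - 2) := by
  intro x u p q hq
  have h := (I1_eqMonomial hf).pq.congr_params (k := e - 2) rfl (by ring)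
  rw [I3, h x u p q hq]
  ring

theorem I4_eqMonomial (hf : EqMonomial f 1 e) :
    EqMonomial (I4 f) (e * (e - 3) * (3 - 2 * e) / 27) (3 * e - 3) := by
  intro x u p q hq
  have h2 := I2_eqMonomial hf
  have hD := (hf.dxTot h2).congr_params (k := 3 * e - 3) rfl (by ring)
  have hmul : q ^ (3 * e - 3) = q ^ (e - 1) * q ^ (2 * e - 2) := by
    rw [← Real.rpow_add hq]
    congr 1
    ring
  rw [I4, I1_eqMonomial hf x u p q hq, h2 x u p q hq, hf.pu_eq_zero x u p hq, hD x u p q hq, hmul]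
  ring

theorem I6_eqMonomial (hf : EqMonomial f 1 e) :
    EqMonomial (I6 f) (-(e * (e - 1) * (e - 2)) / 6) (e - 3) := by
  intro x u p q hq
  have h := (I3_eqMonomial hf).pq.congr_params (k := e - 3) rfl (by ring)
  rw [I6, h x u p q hq]
  ring

end PowerInvariants

theorem EqMonomial.forall_ne_zero_iff {g h : ℝ → ℝ → ℝ → ℝ → ℝ} {c a d k : ℝ}
    (hg : EqMonomial g c a) (hh : EqMonomial h d k) :
    (∀ x u p q : ℝ, 0 < q → g x u p q ≠ 0 ∧ h x u p q ≠ 0) ↔ c ≠ 0 ∧ d ≠ 0 := by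
  constructor
  · intro H
    have := H 0 0 0 1 one_pos
    simpa [hg 0 0 0 1 one_pos, hh 0 0 0 1 one_pos] using this
  · rintro ⟨hc, hd⟩ x u p q hq
    rw [hg x u p q hq, hh x u p q hq]
    exact ⟨mul_ne_zero hc (Real.rpow_pos_of_pos hq _).ne',
      mul_ne_zero hd (Real.rpow_pos_of_pos hq _).ne'⟩

/-- For f = q^e with e = (b−2)/(b−1) (the ODE u''' = (u'')^{(b−2)/(b−1)}), the
relative invariants satisfy the listed formulas on q > 0, and I₄ ≠ 0 together with
I₆ ≠ 0 hold for all q > 0 if and only if b ∉ {−1, 0, 1/2, 2}: for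
b ∉ {−1, 0, 1/2, 1, 2} the ODE belongs to the branch I₄ ≠ 0, I₆ ≠ 0 of
Theorem 3.1, while for b ∈ {−1, 0, 1/2} it does not. -/
theorem canonical_L43_branch (b : ℝ) (hb : b ≠ 1) (e : ℝ) (he : e = (b - 2) / (b - 1)) :
    let f : ℝ → ℝ → ℝ → ℝ → ℝ := fun _ _ _ q => q ^ e
    (∀ x u p q : ℝ, 0 < q →
      I1 f x u p q = -e * q ^ (e - 1) ∧
      I2 f x u p q = e * (e - 3) / 9 * q ^ (2 * e - 2) ∧
      I3 f x u p q = e * (e - 1) / 6 * q ^ (e - 2) ∧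
      I4 f x u p q = e * (e - 3) * (3 - 2 * e) / 27 * q ^ (3 * e - 3) ∧
      I6 f x u p q = -(e * (e - 1) * (e - 2)) / 6 * q ^ (e - 3)) ∧
    ((∀ x u p q : ℝ, 0 < q → I4 f x u p q ≠ 0 ∧ I6 f x u p q ≠ 0) ↔
      (b ≠ -1 ∧ b ≠ 0 ∧ b ≠ 1 / 2 ∧ b ≠ 2)) := by
  intro f
  have hf : EqMonomial f 1 e := fun _ _ _ q _ => (one_mul (q ^ e)).symm
  refine ⟨fun x u p q hq => ⟨I1_eqMonomial hf x u p q hq, I2_eqMonomial hf x u p q hq,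
    I3_eqMonomial hf x u p q hq, I4_eqMonomial hf x u p q hq, I6_eqMonomial hf x u p q hq⟩, ?_⟩
  rw [(I4_eqMonomial hf).forall_ne_zero_iff (I6_eqMonomial hf)]
  have hb' : b - 1 ≠ 0 := sub_ne_zero.mpr hb
  have h4 : e * (e - 3) * (3 - 2 * e) / 27 =
      (b - 2) * (1 - 2 * b) * (b + 1) / (27 * (b - 1) ^ 3) := by
    rw [he]
    field_simp
    ring
  have h6 : -(e * (e - 1) * (e - 2)) / 6 = -(b - 2) * b / (6 * (b - 1) ^ 3) := by
    rw [he]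
    field_simp
    ring
  rw [h4, h6]
  have h2 : b - 2 = 0 ↔ b = 2 := sub_eq_zero
  have hhalf : 1 - 2 * b = 0 ↔ b = 1 / 2 := by constructor <;> intro h <;> linarith
  have hneg : b + 1 = 0 ↔ b = -1 := by constructor <;> intro h <;> linarith
  simp only [ne_eq, div_eq_zero_iff, mul_eq_zero, neg_eq_zero, pow_eq_zero_iff, OfNat.ofNat_ne_zero,
    hb', h2, hhalf, hneg, not_false_eq_true, or_false, not_or]
  tauto

end
end
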